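/- In B₃ let h = (σ₁σ₂)³ and, for k ≥ 0, let u_k denote the braid word σ₁σ₂σ₁σ₂σ₁σ₂ followed by k copies of the negative letter σ₂^{−1} (so u_k represents h·σ₂^{−k}). Then: (i) for all integers d ≥ 1, ℓ ≥ 1 and a₁, …, a_ℓ ≥ 0, setting k = a₁ + ⋯ + a_ℓ, the braid h^d σ₁σ₂^{−a₁} σ₁σ₂^{−a₂} ⋯ σ₁σ₂^{−a_ℓ} is represented by some braid word obtained from u_k by inserting positive letters; (ii) for all integers d ≥ 1 and m < 0, setting k = −m, the braid h^d σ₂^{m} is represented by some braid word obtained from u_k by inserting positive letters. -/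

import Mathlib

/-- The braid relations on `m` generators `σ_1, …, σ_m` (indexed by `Fin m`). -/
def braidRels (m : ℕ) : Set (FreeGroup (Fin m)) :=
  { r | ∃ i j : Fin m, (i : ℕ) + 2 ≤ (j : ℕ) ∧
      r = FreeGroup.of i * FreeGroup.of j * (FreeGroup.of i)⁻¹ * (FreeGroup.of j)⁻¹ } ∪
  { r | ∃ i j : Fin m, (j : ℕ) = (i : ℕ) + 1 ∧
      r = FreeGroup.of i * FreeGroup.of j * FreeGroup.of i *
        (FreeGroup.of j * FreeGroup.of i * FreeGroup.of j)⁻¹ }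

/-- The braid group `B_n`, with generators indexed by `Fin (n-1)`. -/
abbrev BraidGroup (n : ℕ) := PresentedGroup (braidRels (n - 1))

/-- The standard generator `σ_{i+1}` of `B_n`. -/
def braidGen {n : ℕ} (i : Fin (n - 1)) : BraidGroup n := PresentedGroup.of i

/-- A braid word is a list of letters `σ_i^{±1}`: the letter `(i, true)` is the
positive letter `σ_{i+1}` and `(i, false)` is the negative letter `σ_{i+1}⁻¹`. -/
def wordEval {n : ℕ} (w : List (Fin (n - 1) × Bool)) : BraidGroup n :=
  (w.map fun p => if p.2 then braidGen p.1 else (braidGen p.1)⁻¹).prod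

/-- `w` is obtained from `u` by inserting positive letters: `u` is an
order-preserving subsequence of `w`, and each negative letter `σ_i⁻¹` occurs the
same number of times in `w` as in `u`. -/
def InsertPositive {m : ℕ} (u w : List (Fin m × Bool)) : Prop :=
  u.Sublist w ∧ ∀ i : Fin m, w.count (i, false) = u.count (i, false)

/-- `σ₁ ∈ B₃`. -/
def σ₁ : BraidGroup 3 := braidGen ⟨0, by norm_num⟩

/-- `σ₂ ∈ B₃`. -/
def σ₂ : BraidGroup 3 := braidGen ⟨1, by norm_num⟩

/-- The full twist `h = (σ₁σ₂)³ ∈ B₃`. -/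
def h : BraidGroup 3 := (σ₁ * σ₂) ^ 3

/-- The model word `u_k` representing `h · σ₂^{-k}`: the positive word
`σ₁σ₂σ₁σ₂σ₁σ₂` followed by `k` copies of the negative letter `σ₂⁻¹`. -/
def modelWord3 (k : ℕ) : List (Fin (3 - 1) × Bool) :=
  [(⟨0, by norm_num⟩, true), (⟨1, by norm_num⟩, true),
   (⟨0, by norm_num⟩, true), (⟨1, by norm_num⟩, true),
   (⟨0, by norm_num⟩, true), (⟨1, by norm_num⟩, true)] ++
  List.replicate k ((⟨1, by norm_num⟩ : Fin (3 - 1)), false)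

theorem wordEval_append {n : ℕ} (u v : List (Fin (n - 1) × Bool)) :
    wordEval (u ++ v) = wordEval u * wordEval v := by
  simp [wordEval]

theorem wordEval_replicate_neg {n : ℕ} (i : Fin (n - 1)) (k : ℕ) :
    wordEval (List.replicate k (i, false)) = (braidGen i)⁻¹ ^ k := by
  simp [wordEval]

theorem wordEval_modelWord3_zero : wordEval (modelWord3 0) = h := by
  simp [wordEval, modelWord3, h, σ₁, σ₂, pow_succ, mul_assoc]

theorem modelWord3_eq_append (k : ℕ) :
    modelWord3 k = modelWord3 0 ++ List.replicate k ((1 : Fin (3 - 1)), false) := by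
  simp [modelWord3]

theorem count_neg_modelWord3_zero (i : Fin (3 - 1)) : (modelWord3 0).count (i, false) = 0 := by
  simp [modelWord3]

theorem wordEval_flatten_replicate {n : ℕ} (k : ℕ) (u : List (Fin (n - 1) × Bool)) :
    wordEval (List.replicate k u).flatten = wordEval u ^ k := by
  induction k with
  | zero => simp [wordEval]
  | succ k ih => rw [List.replicate_succ, List.flatten_cons, wordEval_append, ih, pow_succ']

/-- Any word with exactly `k` letters `σ₂⁻¹` and no letter `σ₁⁻¹`, preceded by at least one
full twist, is represented by a word obtained from `modelWord3 k` by inserting positive letters. -/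
theorem exists_insertPositive_modelWord3 {d : ℤ} (hd : 1 ≤ d) {k : ℕ}
    {t : List (Fin (3 - 1) × Bool)}
    (ht : ∀ i : Fin (3 - 1), t.count (i, false) =
      (List.replicate k ((1 : Fin (3 - 1)), false)).count (i, false)) :
    ∃ w : List (Fin (3 - 1) × Bool),
      wordEval w = h ^ d * wordEval t ∧ InsertPositive (modelWord3 k) w := by
  obtain ⟨e, rfl⟩ : ∃ e : ℕ, d = ((e + 1 : ℕ) : ℤ) := ⟨(d - 1).toNat, by omega⟩
  refine ⟨(List.replicate e (modelWord3 0)).flatten ++ (modelWord3 0 ++ t), ?_, ?_, fun i => ?_⟩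
  · rw [wordEval_append, wordEval_append, wordEval_flatten_replicate, wordEval_modelWord3_zero,
      zpow_natCast, pow_succ, mul_assoc]
  · rw [modelWord3_eq_append]
    refine List.Sublist.trans (List.Sublist.append_left ?_ _) (List.sublist_append_right _ _)
    rw [List.replicate_sublist_iff, ht, List.count_replicate_self]
  · rw [modelWord3_eq_append k, List.count_append, List.count_append, List.count_append, ht]
    simp only [List.count_flatten, List.map_replicate, List.sum_replicate, smul_eq_mul,
      count_neg_modelWord3_zero, mul_zero, zero_add]

/-- The word `σ₁σ₂^{-a₁} ⋯ σ₁σ₂^{-a_ℓ}`. -/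
def alternatingWord (a : List ℕ) : List (Fin (3 - 1) × Bool) :=
  a.flatMap fun k => ((0 : Fin (3 - 1)), true) :: List.replicate k ((1 : Fin (3 - 1)), false)

theorem wordEval_alternatingWord (a : List ℕ) :
    wordEval (alternatingWord a) = (a.map fun ai => σ₁ * (σ₂⁻¹) ^ ai).prod := by
  induction a with
  | nil => simp [wordEval, alternatingWord]
  | cons k a ih =>
    rw [alternatingWord, List.flatMap_cons, ← alternatingWord, wordEval_append, ih, List.map_cons,
      List.prod_cons]
    simp [wordEval, σ₁, σ₂]

theorem count_neg_alternatingWord (a : List ℕ) (i : Fin (3 - 1)) :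
    (alternatingWord a).count (i, false) =
      (List.replicate a.sum ((1 : Fin (3 - 1)), false)).count (i, false) := by
  induction a with
  | nil => rfl
  | cons k a ih =>
    rw [alternatingWord, List.flatMap_cons, ← alternatingWord, List.count_append, ih,
      List.sum_cons, List.replicate_add, List.count_append]
    simp

/-- Murasugi's right-veering 3-braids of types (a') and (b') are represented by
words obtained from the model words `u_k` by inserting positive letters:
(i) for `d ≥ 1` and `a₁, …, a_ℓ ≥ 0` (`ℓ ≥ 1`), the braid
`h^d σ₁σ₂^{-a₁} ⋯ σ₁σ₂^{-a_ℓ}` comes from `u_{a₁+⋯+a_ℓ}`;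
(ii) for `d ≥ 1` and `m < 0`, the braid `h^d σ₂^m` comes from `u_{-m}`. -/
theorem murasugi_a'_b'_from_model :
    (∀ (d : ℤ), 1 ≤ d → ∀ (a : List ℕ), 1 ≤ a.length →
      ∃ w : List (Fin (3 - 1) × Bool),
        wordEval w = h ^ d * (a.map fun ai => σ₁ * (σ₂⁻¹) ^ ai).prod ∧
        InsertPositive (modelWord3 a.sum) w) ∧
    (∀ (d : ℤ), 1 ≤ d → ∀ (m : ℤ), m < 0 →
      ∃ w : List (Fin (3 - 1) × Bool),
        wordEval w = h ^ d * σ₂ ^ m ∧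
        InsertPositive (modelWord3 (-m).toNat) w) := by
  refine ⟨fun d hd a _ => ?_, fun d hd m hm => ?_⟩
  · rw [← wordEval_alternatingWord]
    exact exists_insertPositive_modelWord3 hd (count_neg_alternatingWord a)
  · have key : wordEval (n := 3) (List.replicate (-m).toNat ((1 : Fin (3 - 1)), false)) = σ₂ ^ m := by
      obtain ⟨k, rfl⟩ : ∃ k : ℕ, m = -(k : ℤ) := ⟨(-m).toNat, by omega⟩
      rw [wordEval_replicate_neg, neg_neg, Int.toNat_natCast, zpow_neg, zpow_natCast, inv_pow]
      rfl
    rw [← key]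
    exact exists_insertPositive_modelWord3 hd fun _ => rfl
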